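/- (Matrix decomposition through the nucleus) Let A, B be proxets and Φ : A ↬ B a proximity matrix. Then for all x ∈ A and y ∈ B, Φ(x,y) = ⨆_{(α,β)} α(x)·β(y), where the supremum ranges over all cuts (α, β) of Φ. -/

import Mathlib

/-- A proximity set (proxet): a set with a proximity map `d : A × A → [0,1]`
that is reflexive, transitive (w.r.t. multiplication) and antisymmetric. -/
class Proxet (A : Type*) where
  d : A → A → ℝ
  d_nonneg : ∀ x y : A, 0 ≤ d x y
  d_le_one : ∀ x y : A, d x y ≤ 1
  d_refl : ∀ x : A, d x x = 1
  d_trans : ∀ x y z : A, d x y * d y z ≤ d x z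
  d_antisymm : ∀ x y : A, d x y = 1 → d y x = 1 → x = y

open Proxet

/-- Residuation on `[0,1]`: `r ⊢ s = 1` if `r ≤ s`, else `s / r`. -/
noncomputable def resid (r s : ℝ) : ℝ := if r ≤ s then 1 else s / r

/-- A lower vector on a proxet `A`: a map `λ : A → [0,1]` with `d(x,y)·λ(y) ≤ λ(x)`. -/
def IsLowerVector (A : Type*) [Proxet A] (lam : A → ℝ) : Prop :=
  (∀ x : A, 0 ≤ lam x ∧ lam x ≤ 1) ∧ ∀ x y : A, d x y * lam y ≤ lam x

/-- An upper vector on a proxet `A`: a map `υ : A → [0,1]` with `υ(x)·d(x,y) ≤ υ(y)`. -/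
def IsUpperVector (A : Type*) [Proxet A] (u : A → ℝ) : Prop :=
  (∀ x : A, 0 ≤ u x ∧ u x ≤ 1) ∧ ∀ x y : A, u x * d x y ≤ u y

/-- A proximity matrix `Φ : A ↬ B`. -/
def IsProxMatrix {A B : Type*} [Proxet A] [Proxet B] (F : A → B → ℝ) : Prop :=
  (∀ (x : A) (y : B), 0 ≤ F x y ∧ F x y ≤ 1) ∧
  ∀ (u x : A) (y v : B), d u x * F x y * d y v ≤ F u v

/-- `(Φ*λ)(b) = ⨅ₓ (λ(x) ⊢ Φ(x,b))`, an upper vector on `B`. -/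
noncomputable def matUp {A B : Type*} (F : A → B → ℝ) (lam : A → ℝ) : B → ℝ :=
  fun b => ⨅ x : A, resid (lam x) (F x b)

/-- `(Φ_*υ)(a) = ⨅_y (υ(y) ⊢ Φ(a,y))`, a lower vector on `A`. -/
noncomputable def matLo {A B : Type*} (F : A → B → ℝ) (u : B → ℝ) : A → ℝ :=
  fun a => ⨅ y : B, resid (u y) (F a y)

/-- A cut of the matrix `Φ`: a pair `(α, β)` of a lower vector on `A` and an
upper vector on `B` with `Φ*α = β` and `Φ_*β = α`. -/
def IsCut {A B : Type*} [Proxet A] [Proxet B] (F : A → B → ℝ)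
    (al : A → ℝ) (be : B → ℝ) : Prop :=
  IsLowerVector A al ∧ IsUpperVector B be ∧ matUp F al = be ∧ matLo F be = al

/-- The residuation adjunction on `[0,1]`. -/
theorem le_resid_iff {r s t : ℝ} (hr : 0 ≤ r) (hs : 0 ≤ s) (ht : t ≤ 1) :
    t ≤ resid r s ↔ t * r ≤ s := by
  unfold resid
  split_ifs with h
  · exact ⟨fun _ => (mul_le_of_le_one_left hr ht).trans h, fun _ => ht⟩
  · exact le_div_iff₀ (hs.trans_lt (not_le.mp h))

theorem resid_nonneg {r s : ℝ} (hr : 0 ≤ r) (hs : 0 ≤ s) : 0 ≤ resid r s :=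
  (le_resid_iff hr hs zero_le_one).2 (by simpa using hs)

theorem resid_le_one {r s : ℝ} (hs : 0 ≤ s) : resid r s ≤ 1 := by
  unfold resid
  split_ifs with h
  · exact le_rfl
  · exact div_le_one_of_le₀ (not_le.mp h).le (hs.trans (not_le.mp h).le)

theorem resid_self (r : ℝ) : resid r r = 1 := if_pos le_rfl

theorem resid_one_left {s : ℝ} (hs : s ≤ 1) : resid 1 s = s := by
  unfold resid
  split_ifs with h
  · exact le_antisymm h hs
  · exact div_one s

theorem bddBelow_range_resid {ι : Type*} {f g : ι → ℝ} (hf : ∀ i, 0 ≤ f i) (hg : ∀ i, 0 ≤ g i) :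
    BddBelow (Set.range fun i => resid (f i) (g i)) :=
  ⟨0, Set.forall_mem_range.2 fun i => resid_nonneg (hf i) (hg i)⟩

/-- The components of a cut multiply to at most the matrix. -/
theorem IsCut.mul_le {A B : Type*} [Proxet A] [Proxet B] {F : A → B → ℝ} (hF : IsProxMatrix F)
    {al : A → ℝ} {be : B → ℝ} (h : IsCut F al be) (x : A) (y : B) : al x * be y ≤ F x y := by
  obtain ⟨hal, hbe, hup, -⟩ := h
  have hle : be y ≤ resid (al x) (F x y) := by
    rw [← hup]
    exact ciInf_le (bddBelow_range_resid (fun a => (hal.1 a).1) fun a => (hF.1 a y).1) x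
  rw [mul_comm]
  exact (le_resid_iff (hal.1 x).1 (hF.1 x y).1 (hbe.1 y).2).1 hle

theorem matLo_row_self {A B : Type*} [Nonempty B] (F : A → B → ℝ) (x : A) :
    matLo F (F x) x = 1 := by
  simp [matLo, resid_self]

/-- Every row of a proximity matrix is the upper component of a cut. -/
theorem isCut_row {A B : Type*} [Proxet A] [Proxet B] [Nonempty B] {F : A → B → ℝ}
    (hF : IsProxMatrix F) (x : A) : IsCut F (matLo F (F x)) (F x) := by
  have hbdd (a : A) : BddBelow (Set.range fun b => resid (F x b) (F a b)) :=
    bddBelow_range_resid (fun b => (hF.1 x b).1) fun b => (hF.1 a b).1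
  have hnonneg (a : A) : 0 ≤ matLo F (F x) a :=
    le_ciInf fun b => resid_nonneg (hF.1 x b).1 (hF.1 a b).1
  have hle_one (a : A) : matLo F (F x) a ≤ 1 :=
    (ciInf_le (hbdd a) (Classical.arbitrary B)).trans (resid_le_one (hF.1 a _).1)
  have hmul (a : A) (b : B) : matLo F (F x) a * F x b ≤ F a b :=
    (le_resid_iff (hF.1 x b).1 (hF.1 a b).1 (hle_one a)).1 (ciInf_le (hbdd a) b)
  refine ⟨⟨fun a => ⟨hnonneg a, hle_one a⟩, fun a a' => le_ciInf fun b => ?_⟩,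
    ⟨hF.1 x, fun b b' => by simpa [d_refl] using hF.2 x x b b'⟩, funext fun b => ?_, rfl⟩
  · refine (le_resid_iff (hF.1 x b).1 (hF.1 a b).1
      (mul_le_one₀ (d_le_one a a') (hnonneg a') (hle_one a'))).2 ?_
    calc d a a' * matLo F (F x) a' * F x b = d a a' * (matLo F (F x) a' * F x b) := mul_assoc ..
      _ ≤ d a a' * F a' b := mul_le_mul_of_nonneg_left (hmul a' b) (d_nonneg a a')
      _ ≤ F a b := by simpa [d_refl] using hF.2 a a' b b
  · have : Nonempty A := ⟨x⟩
    refine le_antisymm ?_ (le_ciInf fun a => ?_)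
    · refine (ciInf_le (bddBelow_range_resid hnonneg fun a => (hF.1 a b).1) x).trans ?_
      rw [matLo_row_self, resid_one_left (hF.1 x b).2]
    · refine (le_resid_iff (hnonneg a) (hF.1 a b).1 (hF.1 x b).2).2 ?_
      rw [mul_comm]
      exact hmul a b

/-- Matrix decomposition through the nucleus: `Φ(x,y) = ⨆_{(α,β) cut} α(x)·β(y)`. -/
theorem stmt16 {A B : Type*} [Proxet A] [Proxet B]
    (F : A → B → ℝ) (hF : IsProxMatrix F) (x : A) (y : B) :
    F x y = ⨆ c : {p : (A → ℝ) × (B → ℝ) // IsCut F p.1 p.2}, c.1.1 x * c.1.2 y := by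
  have : Nonempty B := ⟨y⟩
  let row : {p : (A → ℝ) × (B → ℝ) // IsCut F p.1 p.2} := ⟨(matLo F (F x), F x), isCut_row hF x⟩
  have : Nonempty {p : (A → ℝ) × (B → ℝ) // IsCut F p.1 p.2} := ⟨row⟩
  refine le_antisymm ?_ (ciSup_le fun c => c.2.mul_le hF x y)
  refine le_ciSup_of_le ⟨F x y, Set.forall_mem_range.2 fun c => c.2.mul_le hF x y⟩ row ?_
  simp [row, matLo_row_self]
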